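/- arXiv:2212.11158 — 3 statements merged into one kernel-verified Lean document; each statement's English description precedes it below -/
import Mathlib

section
/- Let D be a standard Borel space, let ρ : D → [0,1] be measurable, and let μ, ν be probability measures on D. Let m_ρ(d₁,d₂) = max{ρ(d₂) − ρ(d₁), 0} on D × D and let c(x,y) = max{y − x, 0} on ℝ × ℝ. Then the Wasserstein lifting of m_ρ between μ and ν equals the Wasserstein lifting of c between the pushforward measures: W(m_ρ)(μ,ν) = W(c)(ρ_*μ, ρ_*ν), where ρ_*μ and ρ_*ν denote the pushforwards of μ and ν along ρ. -/
open MeasureTheory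

/-- The set of couplings of `μ` and `ν`: probability measures on `Ω × Ω`
with marginals `μ` and `ν`. -/
def couplings {Ω : Type*} [MeasurableSpace Ω] (μ ν : Measure Ω) :
    Set (Measure (Ω × Ω)) :=
  {w | IsProbabilityMeasure w ∧ w.map Prod.fst = μ ∧ w.map Prod.snd = ν}

/-- The Wasserstein lifting of a cost `m` to a distance between measures:
the infimum over couplings `w` of `μ` and `ν` of `∫ m dw`. -/
noncomputable def wass {Ω : Type*} [MeasurableSpace Ω] (m : Ω × Ω → ℝ)
    (μ ν : Measure Ω) : ℝ :=
  sInf ((fun w => ∫ x, m x ∂w) '' couplings μ ν)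

open ProbabilityTheory

/-- The conditional law of a point given its image under `f` is almost surely carried by the
corresponding fibre of `f`. -/
lemma condDistrib_id_map_ae_eq_dirac {X Y : Type*} [MeasurableSpace X] [StandardBorelSpace X]
    [Nonempty X] [MeasurableSpace Y] [StandardBorelSpace Y] [Nonempty Y] {f : X → Y}
    (hf : Measurable f) (μ : Measure X) [IsFiniteMeasure μ] :
    ∀ᵐ y ∂μ.map f, (condDistrib id f μ y).map f = Measure.dirac y := by
  filter_upwards [condDistrib_comp f (μ := μ) aemeasurable_id hf, condDistrib_self (μ := μ) f]
    with y hcomp hself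
  rw [← Kernel.map_apply _ hf, ← hcomp, Function.comp_id, hself, Kernel.id_apply]

lemma map_mem_couplings {X Y : Type*} [MeasurableSpace X] [MeasurableSpace Y] {f : X → Y}
    (hf : Measurable f) {μ ν : Measure X} {w : Measure (X × X)} (hw : w ∈ couplings μ ν) :
    w.map (Prod.map f f) ∈ couplings (μ.map f) (ν.map f) := by
  obtain ⟨hprob, rfl, rfl⟩ := hw
  have hff : Measurable (Prod.map f f) := hf.prodMap hf
  refine ⟨Measure.isProbabilityMeasure_map hff.aemeasurable, ?_, ?_⟩
  · rw [Measure.map_map measurable_fst hff, Measure.map_map hf measurable_fst, Prod.map_fst']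
  · rw [Measure.map_map measurable_snd hff, Measure.map_map hf measurable_snd, Prod.map_snd']

/-- Every coupling of pushforward measures lifts to a coupling of the original measures. -/
lemma exists_mem_couplings_map_eq {X Y : Type*} [MeasurableSpace X] [StandardBorelSpace X]
    [MeasurableSpace Y] [StandardBorelSpace Y] {f : X → Y} (hf : Measurable f)
    (μ ν : Measure X) [IsProbabilityMeasure μ] [IsProbabilityMeasure ν]
    {γ : Measure (Y × Y)} (hγ : γ ∈ couplings (μ.map f) (ν.map f)) :
    ∃ w ∈ couplings μ ν, w.map (Prod.map f f) = γ := by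
  obtain ⟨hprob, hfst, hsnd⟩ := hγ
  have : Nonempty X := nonempty_of_isProbabilityMeasure μ
  have : Nonempty Y := this.map f
  set κ := condDistrib id f μ with hκ
  set η := condDistrib id f ν with hη
  refine ⟨(κ ∥ₖ η) ∘ₘ γ, ⟨inferInstance, ?_, ?_⟩, ?_⟩
  · have h : (κ ∥ₖ η).map Prod.fst = κ ∘ₖ Kernel.deterministic Prod.fst measurable_fst := by
      ext1 y
      rw [Kernel.map_apply _ measurable_fst, Kernel.parallelComp_apply,
        Kernel.comp_deterministic_eq_comap, Kernel.comap_apply, Measure.map_fst_prod,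
        measure_univ, one_smul]
    rw [Measure.map_comp _ _ measurable_fst, h, ← Measure.comp_assoc,
      Measure.deterministic_comp_eq_map, hfst, hκ,
      condDistrib_comp_map hf.aemeasurable aemeasurable_id, Measure.map_id]
  · have h : (κ ∥ₖ η).map Prod.snd = η ∘ₖ Kernel.deterministic Prod.snd measurable_snd := by
      ext1 y
      rw [Kernel.map_apply _ measurable_snd, Kernel.parallelComp_apply,
        Kernel.comp_deterministic_eq_comap, Kernel.comap_apply, Measure.map_snd_prod,
        measure_univ, one_smul]
    rw [Measure.map_comp _ _ measurable_snd, h, ← Measure.comp_assoc,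
      Measure.deterministic_comp_eq_map, hsnd, hη,
      condDistrib_comp_map hf.aemeasurable aemeasurable_id, Measure.map_id]
  · have hκ_ae := condDistrib_id_map_ae_eq_dirac hf μ
    have hη_ae := condDistrib_id_map_ae_eq_dirac hf ν
    rw [← hfst] at hκ_ae
    rw [← hsnd] at hη_ae
    have h : ∀ᵐ y ∂γ, (κ ∥ₖ η).map (Prod.map f f) y = Kernel.id y := by
      filter_upwards [ae_of_ae_map measurable_fst.aemeasurable hκ_ae,
        ae_of_ae_map measurable_snd.aemeasurable hη_ae] with y hy₁ hy₂
      rw [Kernel.map_apply _ (hf.prodMap hf), Kernel.parallelComp_apply,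
        ← Measure.map_prod_map _ _ hf hf, hy₁, hy₂, Measure.dirac_prod_dirac, Kernel.id_apply]
    rw [Measure.map_comp _ _ (hf.prodMap hf), Measure.comp_congr h, Measure.id_comp]

/-- on a standard Borel space `D`, for a measurable penalty
function `ρ : D → [0,1]`, the Wasserstein lifting of the induced cost
`m_ρ(d₁,d₂) = max{ρ(d₂) − ρ(d₁), 0}` between `μ` and `ν` equals the
Wasserstein lifting of `c(x,y) = max{y − x, 0}` between the pushforwards
`ρ_*μ` and `ρ_*ν`. -/
theorem wass_penalty_eq_wass_pushforward {D : Type*} [MeasurableSpace D]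
    [StandardBorelSpace D]
    (ρ : D → ℝ) (hρ : Measurable ρ) (hρ01 : ∀ d, ρ d ∈ Set.Icc (0 : ℝ) 1)
    (μ ν : Measure D) [IsProbabilityMeasure μ] [IsProbabilityMeasure ν] :
    wass (fun q : D × D => max (ρ q.2 - ρ q.1) 0) μ ν
      = wass (fun q : ℝ × ℝ => max (q.2 - q.1) 0) (μ.map ρ) (ν.map ρ) := by
  have hcost (w : Measure (D × D)) :
      ∫ q, max (q.2 - q.1) 0 ∂w.map (Prod.map ρ ρ) = ∫ q, max (ρ q.2 - ρ q.1) 0 ∂w :=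
    integral_map (hρ.prodMap hρ).aemeasurable (by fun_prop)
  unfold wass
  congr 1
  ext r
  constructor
  · rintro ⟨w, hw, rfl⟩
    exact ⟨w.map (Prod.map ρ ρ), map_mem_couplings hρ hw, hcost w⟩
  · rintro ⟨γ, hγ, rfl⟩
    obtain ⟨w, hw, rfl⟩ := exists_mem_couplings_map_eq hρ μ ν hγ
    exact ⟨w, hw, (hcost w).symm⟩
end

section
/- Let N ≥ 1 and let ω₁ ≤ ω₂ ≤ … ≤ ω_N and ν₁ ≤ ν₂ ≤ … ≤ ν_N be real numbers. Let μ = (1/N) Σ_{j=1}^N δ_{ω_j} and η = (1/N) Σ_{j=1}^N δ_{ν_j} be the corresponding uniform empirical probability measures on ℝ, and let c(x,y) = max{y − x, 0}. Then W(c)(μ,η) = (1/N) Σ_{j=1}^N max{ν_j − ω_j, 0}; i.e., the sorted (comonotone) pairing achieves the infimum over couplings. -/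
open MeasureTheory

/-- The integral of an arbitrary function against a uniform empirical measure. -/
lemma integral_empirical {Ω : Type*} [MeasurableSpace Ω] [MeasurableSingletonClass Ω]
    (N : ℕ) (x : ℕ → Ω) (f : Ω → ℝ) :
    ∫ t, f t ∂((N : ENNReal)⁻¹ • ∑ j ∈ Finset.Icc 1 N, Measure.dirac (x j))
      = (1 / (N : ℝ)) * ∑ j ∈ Finset.Icc 1 N, f (x j) := by
  rw [integral_smul_measure, integral_finsetSum_measure fun j _ => integrable_dirac (by simp)]
  simp

lemma integrable_empirical {Ω : Type*} [MeasurableSpace Ω] [MeasurableSingletonClass Ω]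
    {N : ℕ} (hN : 1 ≤ N) (x : ℕ → Ω) (f : Ω → ℝ) :
    Integrable f ((N : ENNReal)⁻¹ • ∑ j ∈ Finset.Icc 1 N, Measure.dirac (x j)) := by
  refine Integrable.smul_measure ?_ (by simp; omega)
  exact integrable_finsetSum_measure.2 fun j _ => integrable_dirac (by simp)

lemma map_empirical {Ω Ω' : Type*} [MeasurableSpace Ω] [MeasurableSpace Ω']
    (N : ℕ) (x : ℕ → Ω) {g : Ω → Ω'} (hg : Measurable g) :
    ((N : ENNReal)⁻¹ • ∑ j ∈ Finset.Icc 1 N, Measure.dirac (x j)).map g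
      = (N : ENNReal)⁻¹ • ∑ j ∈ Finset.Icc 1 N, Measure.dirac (g (x j)) := by
  rw [Measure.map_smul, ← Measure.mapₗ_apply_of_measurable hg, map_sum]
  simp [Measure.mapₗ_apply_of_measurable hg, Measure.map_dirac' hg]

lemma isProbabilityMeasure_empirical {Ω : Type*} [MeasurableSpace Ω]
    {N : ℕ} (hN : 1 ≤ N) (x : ℕ → Ω) :
    IsProbabilityMeasure ((N : ENNReal)⁻¹ • ∑ j ∈ Finset.Icc 1 N, Measure.dirac (x j)) := by
  constructor
  simp only [Measure.smul_apply, Measure.finsetSum_apply, measure_univ, Finset.sum_const,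
    Nat.card_Icc, Nat.add_sub_cancel, smul_eq_mul, nsmul_eq_mul, mul_one]
  exact ENNReal.inv_mul_cancel (by simp; omega) (by simp)

/-- A Kantorovich potential for the cost `max (y - x) 0` and the sorted pairing: an antiderivative
of the indicator function of the union of the intervals `(x j, y j]`. -/
lemma exists_sorted_potential (s : Finset ℕ) {x y : ℕ → ℝ}
    (hx : MonotoneOn x s) (hy : MonotoneOn y s) :
    ∃ f : ℝ → ℝ, (∀ a b, f b - f a ≤ max (b - a) 0) ∧
      ∀ j ∈ s, f (y j) - f (x j) = max (y j - x j) 0 := by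
  set A : Set ℝ := ⋃ j ∈ s, Set.Ioc (x j) (y j)
  have hAm : MeasurableSet A := s.measurableSet_biUnion fun j _ => measurableSet_Ioc
  have hint : ∀ a b, IntervalIntegrable (A.indicator (1 : ℝ → ℝ)) volume a b := fun a b =>
    ⟨(integrable_const (1 : ℝ)).indicator hAm, (integrable_const (1 : ℝ)).indicator hAm⟩
  have hsub : ∀ a b, (∫ t in (0 : ℝ)..b, A.indicator (1 : ℝ → ℝ) t)
      - (∫ t in (0 : ℝ)..a, A.indicator (1 : ℝ → ℝ) t) = ∫ t in a..b, A.indicator 1 t :=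
    fun a b => intervalIntegral.integral_interval_sub_left (hint _ _) (hint _ _)
  refine ⟨fun b => ∫ t in (0 : ℝ)..b, A.indicator 1 t, fun a b => ?_, fun j hj => ?_⟩
  · simp only [hsub]
    rcases le_total a b with hab | hab
    · rw [max_eq_left (sub_nonneg.2 hab)]
      calc ∫ t in a..b, A.indicator (1 : ℝ → ℝ) t ≤ ∫ _ in a..b, (1 : ℝ) :=
            intervalIntegral.integral_mono_on hab (hint _ _) (by simp) fun t _ =>
              Set.indicator_le_self' (fun _ _ => zero_le_one) t
        _ = b - a := by simp
    · rw [intervalIntegral.integral_symm]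
      refine le_max_of_le_right (neg_nonpos.2 ?_)
      exact intervalIntegral.integral_nonneg hab fun t _ =>
        Set.indicator_nonneg (fun _ _ => zero_le_one) t
  · simp only [hsub]
    rcases le_total (x j) (y j) with hxy | hxy
    · rw [max_eq_left (sub_nonneg.2 hxy), intervalIntegral.integral_of_le hxy,
        setIntegral_congr_fun (g := fun _ => (1 : ℝ)) measurableSet_Ioc]
      · simp [hxy]
      · exact fun t ht => Set.indicator_of_mem (Set.mem_iUnion₂.2 ⟨j, hj, ht⟩) _
    · rw [max_eq_right (sub_nonpos.2 hxy), intervalIntegral.integral_of_ge hxy,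
        setIntegral_congr_fun (g := fun _ => (0 : ℝ)) measurableSet_Ioc]
      · simp
      · intro t ht
        refine Set.indicator_of_notMem (fun htA => ?_) _
        obtain ⟨i, hi, hti⟩ := Set.mem_iUnion₂.1 htA
        rcases le_total i j with hij | hij
        · exact absurd (hti.2.trans (hy hi hj hij)) (not_le.2 ht.1)
        · exact absurd (ht.2.trans (hx hj hi hij)) (not_le.2 hti.1)

lemma monotoneOn_Icc_of_le_add_one {N : ℕ} {x : ℕ → ℝ}
    (h : ∀ j, 1 ≤ j → j < N → x j ≤ x (j + 1)) :
    MonotoneOn x (Finset.Icc 1 N : Finset ℕ) := by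
  intro i hi j hj hij
  simp only [Finset.coe_Icc, Set.mem_Icc] at hi hj
  obtain ⟨-, hj⟩ := hj
  induction j, hij using Nat.le_induction with
  | base => exact le_rfl
  | succ k hk ih => exact (ih (by omega)).trans (h k (by omega) (by omega))

/-- Weak Kantorovich duality for the cost `max (y - x) 0`. -/
lemma integral_sub_integral_le_of_mem_couplings {μ η : Measure ℝ} {w : Measure (ℝ × ℝ)}
    (hw : w ∈ couplings μ η) {f : ℝ → ℝ} (hf : ∀ a b, f b - f a ≤ max (b - a) 0)
    (hfμ : Integrable f μ) (hfη : Integrable f η)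
    (hμ : Integrable id μ) (hη : Integrable id η) :
    ∫ t, f t ∂η - ∫ t, f t ∂μ ≤ ∫ q, max (q.2 - q.1) 0 ∂w := by
  obtain ⟨-, rfl, rfl⟩ := hw
  rw [integral_map measurable_snd.aemeasurable hfη.1,
    integral_map measurable_fst.aemeasurable hfμ.1,
    ← integral_sub (f := fun q : ℝ × ℝ => f q.2) (g := fun q : ℝ × ℝ => f q.1)
      (hfη.comp_measurable measurable_snd) (hfμ.comp_measurable measurable_fst)]
  refine integral_mono
    ((hfη.comp_measurable measurable_snd).sub (hfμ.comp_measurable measurable_fst)) ?_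
    fun q => hf _ _
  exact ((hη.comp_measurable measurable_snd).sub (hμ.comp_measurable measurable_fst)).pos_part

/-- for sorted samples `ω₁ ≤ … ≤ ω_N` and `ν₁ ≤ … ≤ ν_N`
(indexed from 1), the Wasserstein lifting of the cost `c(x,y) = max{y − x, 0}`
between the uniform empirical measures `(1/N) Σ_j δ_{ω_j}` and
`(1/N) Σ_j δ_{ν_j}` equals `(1/N) Σ_{j=1}^N max{ν_j − ω_j, 0}`: the sorted
(comonotone) pairing achieves the infimum over couplings. -/
theorem wass_empirical_sorted (N : ℕ) (hN : 1 ≤ N) (ω ν : ℕ → ℝ)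
    (hω : ∀ j, 1 ≤ j → j < N → ω j ≤ ω (j + 1))
    (hν : ∀ j, 1 ≤ j → j < N → ν j ≤ ν (j + 1)) :
    wass (fun q : ℝ × ℝ => max (q.2 - q.1) 0)
        ((N : ENNReal)⁻¹ • ∑ j ∈ Finset.Icc 1 N, Measure.dirac (ω j))
        ((N : ENNReal)⁻¹ • ∑ j ∈ Finset.Icc 1 N, Measure.dirac (ν j))
      = (1 / (N : ℝ)) * ∑ j ∈ Finset.Icc 1 N, max (ν j - ω j) 0 := by
  refine IsLeast.csInf_eq ⟨⟨(N : ENNReal)⁻¹ • ∑ j ∈ Finset.Icc 1 N, Measure.dirac (ω j, ν j),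
    ⟨isProbabilityMeasure_empirical hN _, map_empirical N _ measurable_fst,
      map_empirical N _ measurable_snd⟩, integral_empirical N _ _⟩, ?_⟩
  rintro _ ⟨w, hw, rfl⟩
  obtain ⟨f, hf, hfs⟩ := exists_sorted_potential (Finset.Icc 1 N)
    (monotoneOn_Icc_of_le_add_one hω) (monotoneOn_Icc_of_le_add_one hν)
  refine le_trans (le_of_eq ?_) (integral_sub_integral_le_of_mem_couplings hw hf
    (integrable_empirical hN _ _) (integrable_empirical hN _ _)
    (integrable_empirical hN _ _) (integrable_empirical hN _ _))
  rw [integral_empirical, integral_empirical, ← mul_sub, ← Finset.sum_sub_distrib,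
    Finset.sum_congr rfl hfs]
end

section
/- Let N, ℓ ≥ 1 and let ω₁ ≤ ω₂ ≤ … ≤ ω_N and ν₁ ≤ ν₂ ≤ … ≤ ν_{ℓN} be real numbers. Let μ = (1/N) Σ_{j=1}^N δ_{ω_j} and η = (1/(ℓN)) Σ_{h=1}^{ℓN} δ_{ν_h} be the corresponding uniform empirical probability measures on ℝ, and let c(x,y) = max{y − x, 0}. Then W(c)(μ,η) = (1/(ℓN)) Σ_{h=1}^{ℓN} max{ν_h − ω_{⌈h/ℓ⌉}, 0}. -/
open MeasureTheory

/-- Kantorovich potential for sorted samples `a` and `b`: the Lebesgue measure of the part of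
`⋃ i ∈ s, [a i, b i)` that lies to the left of `t`. -/
noncomputable def sortedPotential {ι : Type*} (s : Finset ι) (a b : ι → ℝ) (t : ℝ) : ℝ :=
  (volume.restrict (⋃ i ∈ s, Set.Ico (a i) (b i))).real (Set.Iic t)

section Potential

variable {ι : Type*} (s : Finset ι) (a b : ι → ℝ)

lemma isFiniteMeasure_restrict_biUnion_Ico :
    IsFiniteMeasure (volume.restrict (⋃ i ∈ s, Set.Ico (a i) (b i))) := by
  rw [isFiniteMeasure_restrict]
  refine ((measure_biUnion_finset_le s _).trans_lt ?_).ne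
  exact ENNReal.sum_lt_top.2 fun i _ => by simp

lemma sortedPotential_sub {x y : ℝ} (h : x ≤ y) :
    sortedPotential s a b y - sortedPotential s a b x =
      (volume.restrict (⋃ i ∈ s, Set.Ico (a i) (b i))).real (Set.Ioc x y) := by
  have := isFiniteMeasure_restrict_biUnion_Ico s a b
  unfold sortedPotential
  rw [← measureReal_sdiff (Set.Iic_subset_Iic.2 h) measurableSet_Iic, Set.Iic_sdiff_Iic]

lemma monotone_sortedPotential : Monotone (sortedPotential s a b) := fun x y h => by
  rw [← sub_nonneg, sortedPotential_sub s a b h]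
  exact measureReal_nonneg

lemma sortedPotential_sub_le (x y : ℝ) :
    sortedPotential s a b y - sortedPotential s a b x ≤ max (y - x) 0 := by
  rcases le_total x y with h | h
  · rw [sortedPotential_sub s a b h]
    refine le_max_of_le_left ?_
    calc _ ≤ volume.real (Set.Ioc x y) :=
          ENNReal.toReal_mono (by simp) (Measure.restrict_apply_le _ _)
      _ = y - x := Real.volume_real_Ioc_of_le h
  · exact le_max_of_le_right (sub_nonpos.2 (monotone_sortedPotential s a b h))

lemma sortedPotential_sub_eq [LinearOrder ι] {s : Finset ι} {a b : ι → ℝ}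
    (ha : MonotoneOn a s) (hb : MonotoneOn b s) {i : ι} (hi : i ∈ s) :
    sortedPotential s a b (b i) - sortedPotential s a b (a i) = max (b i - a i) 0 := by
  rcases le_total (a i) (b i) with h | h
  · rw [sortedPotential_sub s a b h, max_eq_left (sub_nonneg.2 h),
      ← measureReal_congr (Ioo_ae_eq_Ioc (a := a i) (b := b i)),
      measureReal_restrict_apply measurableSet_Ioo, Set.inter_eq_left.2,
      Real.volume_real_Ioo_of_le h]
    exact Set.Ioo_subset_Ico_self.trans
      (Set.subset_biUnion_of_mem (u := fun i => Set.Ico (a i) (b i)) (Finset.mem_coe.2 hi))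
  · rw [max_eq_right (sub_nonpos.2 h), ← neg_sub, sortedPotential_sub s a b h,
      ← measureReal_congr (Ioo_ae_eq_Ioc (a := b i) (b := a i)),
      measureReal_restrict_apply measurableSet_Ioo, neg_eq_zero]
    have : Set.Ioo (b i) (a i) ∩ ⋃ i ∈ s, Set.Ico (a i) (b i) = ∅ := by
      refine Set.eq_empty_of_forall_notMem ?_
      rintro t ⟨⟨h₁, h₂⟩, ht⟩
      obtain ⟨k, hk, h₃, h₄⟩ := Set.mem_iUnion₂.1 ht
      rcases le_total i k with hik | hik
      · exact ((ha hi hk hik).trans h₃).not_gt h₂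
      · exact ((hb hk hi hik).trans_lt h₁).not_gt h₄
    simp [this]

end Potential

/-- The uniform empirical measure of a finite family of points. -/
noncomputable def empiricalMeasure {ι Ω : Type*} [MeasurableSpace Ω] (s : Finset ι) (x : ι → Ω) :
    Measure Ω :=
  (s.card : ENNReal)⁻¹ • ∑ i ∈ s, Measure.dirac (x i)

section Empirical

variable {ι Ω Ω' : Type*} [MeasurableSpace Ω] [MeasurableSpace Ω'] {s : Finset ι}

lemma map_empiricalMeasure (x : ι → Ω) {f : Ω → Ω'} (hf : Measurable f) :
    (empiricalMeasure s x).map f = empiricalMeasure s fun i => f (x i) := by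
  rw [empiricalMeasure, Measure.map_smul, ← Measure.mapₗ_apply_of_measurable hf, map_sum]
  simp [Measure.mapₗ_apply_of_measurable hf, Measure.map_dirac' hf, empiricalMeasure]

lemma isProbabilityMeasure_empiricalMeasure (hs : s.Nonempty) (x : ι → Ω) :
    IsProbabilityMeasure (empiricalMeasure s x) := by
  refine ⟨?_⟩
  simp only [empiricalMeasure, Measure.smul_apply, Measure.finsetSum_apply, measure_univ,
    Finset.sum_const, smul_eq_mul, nsmul_eq_mul, mul_one]
  exact ENNReal.inv_mul_cancel (by simpa using hs.ne_empty) (by simp)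

lemma integrable_empiricalMeasure [MeasurableSingletonClass Ω] (hs : s.Nonempty) (x : ι → Ω)
    (f : Ω → ℝ) : Integrable f (empiricalMeasure s x) := by
  refine Integrable.smul_measure ?_ (by simpa using hs.ne_empty)
  exact integrable_finsetSum_measure.2 fun i _ => integrable_dirac (by simp)

lemma integral_empiricalMeasure [MeasurableSingletonClass Ω] (x : ι → Ω) (f : Ω → ℝ) :
    ∫ y, f y ∂(empiricalMeasure s x) = 1 / (s.card : ℝ) * ∑ i ∈ s, f (x i) := by
  rw [empiricalMeasure, integral_smul_measure,
    integral_finsetSum_measure fun i _ => integrable_dirac (by simp)]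
  simp

end Empirical

/-- Sorted samples of equal size are optimally coupled in order. -/
theorem wass_empiricalMeasure_of_monotoneOn {ι : Type*} [LinearOrder ι] {s : Finset ι}
    (hs : s.Nonempty) {a b : ι → ℝ} (ha : MonotoneOn a s) (hb : MonotoneOn b s) :
    wass (fun q : ℝ × ℝ => max (q.2 - q.1) 0) (empiricalMeasure s a) (empiricalMeasure s b) =
      1 / (s.card : ℝ) * ∑ i ∈ s, max (b i - a i) 0 := by
  refine IsLeast.csInf_eq ⟨⟨empiricalMeasure s fun i => (a i, b i),
    ⟨isProbabilityMeasure_empiricalMeasure hs _, map_empiricalMeasure _ measurable_fst,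
      map_empiricalMeasure _ measurable_snd⟩, integral_empiricalMeasure _ _⟩, ?_⟩
  rintro _ ⟨w, ⟨-, h₁, h₂⟩, rfl⟩
  have hfst (g : ℝ → ℝ) : Integrable g (w.map Prod.fst) :=
    h₁ ▸ integrable_empiricalMeasure hs a g
  have hsnd (g : ℝ → ℝ) : Integrable g (w.map Prod.snd) :=
    h₂ ▸ integrable_empiricalMeasure hs b g
  set f := sortedPotential s a b
  have hf₁ : Integrable (fun q : ℝ × ℝ => f q.1) w := (hfst f).comp_measurable measurable_fst
  have hf₂ : Integrable (fun q : ℝ × ℝ => f q.2) w := (hsnd f).comp_measurable measurable_snd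
  have hcost : Integrable (fun q : ℝ × ℝ => max (q.2 - q.1) 0) w :=
    (((hsnd id).comp_measurable measurable_snd).sub
      ((hfst id).comp_measurable measurable_fst)).pos_part
  calc 1 / (s.card : ℝ) * ∑ i ∈ s, max (b i - a i) 0
      = ∫ y, f y ∂(w.map Prod.snd) - ∫ x, f x ∂(w.map Prod.fst) := by
        rw [h₁, h₂, integral_empiricalMeasure, integral_empiricalMeasure, ← mul_sub,
          ← Finset.sum_sub_distrib]
        exact congrArg _ (Finset.sum_congr rfl fun i hi => (sortedPotential_sub_eq ha hb hi).symm)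
    _ = ∫ q, (f q.2 - f q.1) ∂w := by
        rw [integral_sub hf₂ hf₁, integral_map measurable_snd.aemeasurable (hsnd f).1,
          integral_map measurable_fst.aemeasurable (hfst f).1]
    _ ≤ ∫ q, max (q.2 - q.1) 0 ∂w :=
        integral_mono (hf₂.sub hf₁) hcost fun q => sortedPotential_sub_le s a b q.1 q.2

lemma toNat_ceil_div_eq_succ {l : ℕ} (n : ℕ) {i : ℕ} (h₁ : 1 ≤ i) (h₂ : i ≤ l) :
    ⌈((l * n + i : ℕ) : ℚ) / (l : ℚ)⌉.toNat = n + 1 := by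
  have hl : (0 : ℚ) < l := by exact_mod_cast h₁.trans h₂
  have : ⌈((l * n + i : ℕ) : ℚ) / (l : ℚ)⌉ = (n + 1 : ℤ) := by
    have h₁' : (1 : ℚ) ≤ i := by exact_mod_cast h₁
    have h₂' : (i : ℚ) ≤ l := by exact_mod_cast h₂
    rw [Int.ceil_eq_iff, lt_div_iff₀ hl, div_le_iff₀ hl]
    push_cast
    constructor <;> linarith
  omega

lemma sum_Icc_toNat_ceil_div {M : Type*} [AddCommMonoid M] (N l : ℕ) (g : ℕ → M) :
    ∑ h ∈ Finset.Icc 1 (l * N), g ⌈(h : ℚ) / (l : ℚ)⌉.toNat = l • ∑ j ∈ Finset.Icc 1 N, g j := by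
  simp only [← Finset.Ico_add_one_right_eq_Icc, Finset.sum_Ico_eq_sum_range, Nat.add_sub_cancel]
  induction N with
  | zero => simp
  | succ n ih =>
    rw [mul_add_one, Finset.sum_range_add, ih, Finset.sum_range_succ, smul_add]
    congr 1
    rw [Finset.sum_congr rfl (g := fun _ => g (1 + n)), Finset.sum_const, Finset.card_range]
    intro i hi
    rw [← add_assoc, add_comm 1, add_assoc, toNat_ceil_div_eq_succ n (by omega)
      (by have := Finset.mem_range.1 hi; omega), add_comm]

lemma toNat_ceil_div_mem_Icc {N l h : ℕ} (hl : 1 ≤ l) (hh : h ∈ Finset.Icc 1 (l * N)) :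
    ⌈(h : ℚ) / (l : ℚ)⌉.toNat ∈ Set.Icc 1 N := by
  rw [Finset.mem_Icc] at hh
  have hl' : (0 : ℚ) < l := by exact_mod_cast hl
  have hpos : 0 < ⌈(h : ℚ) / (l : ℚ)⌉ := Int.ceil_pos.2 (div_pos (by exact_mod_cast hh.1) hl')
  have hle : ⌈(h : ℚ) / (l : ℚ)⌉ ≤ N := by
    rw [Int.ceil_le, div_le_iff₀ hl']
    rw [mul_comm] at hh
    exact_mod_cast hh.2
  constructor <;> omega

lemma monotoneOn_Icc_of_le_add_one_s8 {n : ℕ} {f : ℕ → ℝ}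
    (hf : ∀ j, 1 ≤ j → j < n → f j ≤ f (j + 1)) : MonotoneOn f (Set.Icc 1 n) :=
  monotoneOn_of_le_add_one Set.ordConnected_Icc fun j _ hj hj' =>
    hf j hj.1 (Nat.lt_of_succ_le hj'.2)

lemma empiricalMeasure_Icc_toNat_ceil_div {Ω : Type*} [MeasurableSpace Ω] {N l : ℕ} (hl : 1 ≤ l)
    (x : ℕ → Ω) :
    empiricalMeasure (Finset.Icc 1 (l * N)) (fun h => x ⌈(h : ℚ) / (l : ℚ)⌉.toNat) =
      (N : ENNReal)⁻¹ • ∑ j ∈ Finset.Icc 1 N, Measure.dirac (x j) := by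
  have hl' : (l : ENNReal) ≠ 0 := by exact_mod_cast (Nat.one_le_iff_ne_zero.1 hl)
  rw [empiricalMeasure, sum_Icc_toNat_ceil_div N l fun j => Measure.dirac (x j), Nat.card_Icc,
    Nat.add_sub_cancel, ← Nat.cast_smul_eq_nsmul ENNReal, smul_smul, Nat.cast_mul,
    ENNReal.mul_inv (.inl hl') (.inl (by simp)), mul_right_comm,
    ENNReal.inv_mul_cancel hl' (by simp), one_mul]

/-- for sorted samples `ω₁ ≤ … ≤ ω_N` and `ν₁ ≤ … ≤ ν_{ℓN}`
(indexed from 1), the Wasserstein lifting of the cost `c(x,y) = max{y − x, 0}`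
between the uniform empirical measures `(1/N) Σ_j δ_{ω_j}` and
`(1/(ℓN)) Σ_h δ_{ν_h}` equals
`(1/(ℓN)) Σ_{h=1}^{ℓN} max{ν_h − ω_{⌈h/ℓ⌉}, 0}`. -/
theorem wass_empirical_sorted_ratio (N l : ℕ) (hN : 1 ≤ N) (hl : 1 ≤ l)
    (ω ν : ℕ → ℝ)
    (hω : ∀ j, 1 ≤ j → j < N → ω j ≤ ω (j + 1))
    (hν : ∀ j, 1 ≤ j → j < l * N → ν j ≤ ν (j + 1)) :
    wass (fun q : ℝ × ℝ => max (q.2 - q.1) 0)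
        ((N : ENNReal)⁻¹ • ∑ j ∈ Finset.Icc 1 N, Measure.dirac (ω j))
        (((l * N : ℕ) : ENNReal)⁻¹ • ∑ h ∈ Finset.Icc 1 (l * N), Measure.dirac (ν h))
      = (1 / ((l * N : ℕ) : ℝ)) *
          ∑ h ∈ Finset.Icc 1 (l * N), max (ν h - ω (⌈(h : ℚ) / (l : ℚ)⌉.toNat)) 0 := by
  have hmono : MonotoneOn (fun h : ℕ => ω ⌈(h : ℚ) / (l : ℚ)⌉.toNat)
      (Finset.Icc 1 (l * N) : Finset ℕ) := fun h hh k hk hhk =>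
    monotoneOn_Icc_of_le_add_one_s8 hω (toNat_ceil_div_mem_Icc hl hh) (toNat_ceil_div_mem_Icc hl hk)
      (Int.toNat_le_toNat (Int.ceil_mono (by gcongr)))
  have hν' : MonotoneOn ν (Finset.Icc 1 (l * N) : Finset ℕ) := by
    simpa using monotoneOn_Icc_of_le_add_one_s8 hν
  have hne : (Finset.Icc 1 (l * N)).Nonempty := Finset.nonempty_Icc.2 (Nat.mul_pos hl hN)
  have key := wass_empiricalMeasure_of_monotoneOn hne hmono hν'
  rw [empiricalMeasure_Icc_toNat_ceil_div hl] at key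
  simpa only [empiricalMeasure, Nat.card_Icc, Nat.add_sub_cancel] using key
end
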